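/- arXiv:2102.01071 — 6 statements merged into one kernel-verified Lean document; each statement's English description precedes it below -/
import Mathlib

section
/- Let i, j, k, l be four pairwise distinct vertices of G such that neither ⟨ij⟩ nor ⟨kl⟩ is an edge of G. If d_ij(G) > d_ij(G + ⟨kl⟩) (in particular, i and j are connected in G + ⟨kl⟩), then Φ_i(G) < Φ_i(G + ⟨kl⟩) and Φ_j(G) < Φ_j(G + ⟨kl⟩). -/
open Finset
open scoped Classical

variable {V : Type*} [Fintype V] [DecidableEq V]

/-- Harmonic centrality (closeness) of `u` in `G`:  `Φ_u(G) = ∑_{v ≠ u} 1/d_uv(G)`,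
with the convention `1/∞ = 0` (Mathlib's `SimpleGraph.dist` is `0` on unreachable pairs,
and `(0 : ℝ)⁻¹ = 0`). -/
noncomputable def Phi (G : SimpleGraph V) (u : V) : ℝ :=
  ∑ v ∈ Finset.univ.filter (· ≠ u), ((G.dist u v : ℝ))⁻¹

/-- Local resource availability of `u` from `v` in `G`:
`α_uv(G) = p(1−q)/(d_uv(G)·Φ_v(G))` when `u` and `v` are connected in `G`, else `0`. -/
noncomputable def alpha (p q : ℝ) (G : SimpleGraph V) (u v : V) : ℝ :=
  if G.Reachable u v then p * (1 - q) / ((G.dist u v : ℝ) * Phi G v) else 0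

theorem inv_dist_le_inv_dist_of_le {W : Type*} {G H : SimpleGraph W} (h : G ≤ H) (u v : W) :
    ((G.dist u v : ℝ))⁻¹ ≤ ((H.dist u v : ℝ))⁻¹ := by
  by_cases hr : G.Reachable u v
  · rcases eq_or_ne u v with rfl | hne
    · simp
    · have hpos := (hr.mono h).pos_dist_of_ne hne
      have hle := hr.dist_anti h
      gcongr
  · simp [SimpleGraph.dist_eq_zero_of_not_reachable hr]

theorem inv_dist_lt_inv_dist_of_edist_lt {W : Type*} {G H : SimpleGraph W} {u v : W}
    (hne : u ≠ v) (hd : H.edist u v < G.edist u v) :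
    ((G.dist u v : ℝ))⁻¹ < ((H.dist u v : ℝ))⁻¹ := by
  have hH : H.Reachable u v := SimpleGraph.reachable_of_edist_ne_top hd.ne_top
  have hpos := hH.pos_dist_of_ne hne
  by_cases hr : G.Reachable u v
  · have hlt : H.dist u v < G.dist u v := by
      rw [← hH.coe_dist_eq_edist, ← hr.coe_dist_eq_edist] at hd
      exact_mod_cast hd
    gcongr
  · rw [SimpleGraph.dist_eq_zero_of_not_reachable hr]
    simpa using hpos

theorem Phi_lt_Phi_of_edist_lt {G H : SimpleGraph V} (h : G ≤ H) {u v : V}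
    (hne : u ≠ v) (hd : H.edist u v < G.edist u v) : Phi G u < Phi H u :=
  Finset.sum_lt_sum (fun w _ => inv_dist_le_inv_dist_of_le h u w)
    ⟨v, by simpa using hne.symm, inv_dist_lt_inv_dist_of_edist_lt hne hd⟩

/-- If `i, j, k, l` are pairwise distinct, `⟨ij⟩, ⟨kl⟩ ∉ G`, and
`d_ij(G) > d_ij(G + ⟨kl⟩)`, then `Φ_i(G) < Φ_i(G + ⟨kl⟩)` and `Φ_j(G) < Φ_j(G + ⟨kl⟩)`. -/
theorem stmt_0 (G : SimpleGraph V) (i j k l : V)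
    (hij : i ≠ j) (hik : i ≠ k) (hil : i ≠ l) (hjk : j ≠ k) (hjl : j ≠ l) (hkl : k ≠ l)
    (hije : ¬ G.Adj i j) (hkle : ¬ G.Adj k l)
    (hd : (G ⊔ SimpleGraph.edge k l).edist i j < G.edist i j) :
    Phi G i < Phi (G ⊔ SimpleGraph.edge k l) i ∧
      Phi G j < Phi (G ⊔ SimpleGraph.edge k l) j := by
  refine ⟨Phi_lt_Phi_of_edist_lt le_sup_left hij hd,
    Phi_lt_Phi_of_edist_lt le_sup_left hij.symm ?_⟩
  rwa [SimpleGraph.edist_comm, G.edist_comm]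
end

section
/- Let i ≠ j be vertices of G such that ⟨ij⟩ is not an edge of G. Then α_ij(G + ⟨ij⟩) > α_ij(G); that is, adding the link ⟨ij⟩ strictly increases the local resource availability of i from j. -/
open Finset
open scoped Classical

variable {V : Type*} [Fintype V] [DecidableEq V]

theorem SimpleGraph.Walk.reachable_and_dist_le_mul_length {W : Type*} {G H : SimpleGraph W} {d : ℕ}
    (hadj : ∀ a b, H.Adj a b → G.Reachable a b ∧ G.dist a b ≤ d) {a b : W} (w : H.Walk a b) :
    G.Reachable a b ∧ G.dist a b ≤ d * w.length := by
  induction w with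
  | nil => simp
  | @cons a b c h w ih =>
    obtain ⟨hr, hd⟩ := hadj a b h
    refine ⟨hr.trans ih.1, ?_⟩
    obtain ⟨x, hx⟩ := hr.exists_walk_length_eq_dist
    obtain ⟨y, hy⟩ := ih.1.exists_walk_length_eq_dist
    have hxy := SimpleGraph.dist_le (x.append y)
    rw [SimpleGraph.Walk.length_append] at hxy
    rw [SimpleGraph.Walk.length_cons, mul_add]
    linarith [ih.2]

theorem Phi_pos_of_adj {G : SimpleGraph V} {u v : V} (h : G.Adj u v) : 0 < Phi G u := by
  refine Finset.sum_pos' (fun w _ => by positivity) ⟨v, by simp [h.ne'], ?_⟩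
  rw [SimpleGraph.dist_eq_one_iff_adj.mpr h]
  norm_num

/-- Joining `j` to a non-neighbour `i` in its component increases the closeness of `j` by a factor
smaller than the old distance from `i` to `j`. -/
theorem Phi_sup_edge_lt {G : SimpleGraph V} {i j : V} (hij : i ≠ j) (hije : ¬ G.Adj i j)
    (hr : G.Reachable i j) :
    Phi (G ⊔ SimpleGraph.edge i j) j < (G.dist i j : ℝ) * Phi G j := by
  have hd : 2 ≤ G.dist i j := by
    have h0 := hr.pos_dist_of_ne hij
    have h1 : G.dist i j ≠ 1 := fun h => hije (SimpleGraph.dist_eq_one_iff_adj.mp h)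
    omega
  have hadj : ∀ a b, (G ⊔ SimpleGraph.edge i j).Adj a b →
      G.Reachable a b ∧ G.dist a b ≤ G.dist i j := by
    intro a b h
    rw [SimpleGraph.sup_adj, SimpleGraph.edge_adj] at h
    rcases h with h | ⟨⟨rfl, rfl⟩ | ⟨rfl, rfl⟩, _⟩
    · refine ⟨h.reachable, ?_⟩
      rw [SimpleGraph.dist_eq_one_iff_adj.mpr h]
      omega
    · exact ⟨hr, le_rfl⟩
    · exact ⟨hr.symm, SimpleGraph.dist_comm.le⟩
  unfold Phi
  rw [Finset.mul_sum]
  refine Finset.sum_lt_sum (fun v hv => ?_) ?_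
  · have hvj : v ≠ j := by simpa using hv
    by_cases hv' : (G ⊔ SimpleGraph.edge i j).Reachable j v
    · obtain ⟨w, hw⟩ := hv'.exists_walk_length_eq_dist
      obtain ⟨h1, h2⟩ := w.reachable_and_dist_le_mul_length hadj
      rw [hw] at h2
      have h3 : (0 : ℝ) < G.dist j v := by exact_mod_cast h1.pos_dist_of_ne hvj.symm
      have h4 : (0 : ℝ) < (G ⊔ SimpleGraph.edge i j).dist j v := by
        exact_mod_cast hv'.pos_dist_of_ne hvj.symm
      have h5 : (G.dist j v : ℝ) ≤ G.dist i j * (G ⊔ SimpleGraph.edge i j).dist j v := by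
        exact_mod_cast h2
      rw [← div_eq_mul_inv, inv_eq_one_div, div_le_div_iff₀ h4 h3]
      linarith
    · rw [SimpleGraph.dist_eq_zero_of_not_reachable hv']
      simp only [Nat.cast_zero, inv_zero]
      positivity
  · obtain ⟨w⟩ := hr.symm
    cases w with
    | nil => exact absurd rfl hij
    | @cons _ v _ h w =>
      refine ⟨v, by simp [h.ne'], ?_⟩
      have h' : (G ⊔ SimpleGraph.edge i j).Adj j v := Or.inl h
      rw [SimpleGraph.dist_eq_one_iff_adj.mpr h, SimpleGraph.dist_eq_one_iff_adj.mpr h']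
      have : (2 : ℝ) ≤ G.dist i j := by exact_mod_cast hd
      norm_num
      linarith

/-- adding the link `⟨ij⟩` strictly increases the local resource
availability of `i` from `j`. -/
theorem stmt_2 (G : SimpleGraph V) (i j : V) (hij : i ≠ j) (hije : ¬ G.Adj i j)
    (p q : ℝ) (hp0 : 0 < p) (hp1 : p < 1) (hq0 : 0 < q) (hq1 : q < 1) :
    alpha p q (G ⊔ SimpleGraph.edge i j) i j > alpha p q G i j := by
  have hadj : (G ⊔ SimpleGraph.edge i j).Adj i j :=
    Or.inr ((SimpleGraph.edge_adj i j i j).mpr ⟨Or.inl ⟨rfl, rfl⟩, hij⟩)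
  have hpq : 0 < p * (1 - q) := mul_pos hp0 (sub_pos.mpr hq1)
  have hPhi := Phi_pos_of_adj hadj.symm
  unfold alpha
  rw [if_pos hadj.reachable, SimpleGraph.dist_eq_one_iff_adj.mpr hadj, Nat.cast_one, one_mul]
  split_ifs with hr
  · exact div_lt_div_of_pos_left hpq hPhi (Phi_sup_edge_lt hij hije hr)
  · exact div_pos hpq hPhi
end

section
/- Let i ≠ j be vertices of G such that ⟨ij⟩ is not an edge of G. Then α_ij(G + ⟨ij⟩) > α_ij(G) and α_ji(G + ⟨ij⟩) > α_ji(G); that is, the link ⟨ij⟩ is strictly beneficial to both i and j with respect to their local resource availabilities from each other. -/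
open Finset
open scoped Classical

variable {V : Type*} [Fintype V] [DecidableEq V]

namespace SimpleGraph

/-- If every edge of `H` joins vertices at distance at most `d` in `G`, then a walk in `H`
bounds the distance in `G` up to the factor `d`. -/
theorem Walk.reachable_and_dist_le_mul_length_s4 {W : Type*} {G H : SimpleGraph W} {d : ℕ}
    (h : ∀ x y, H.Adj x y → G.Reachable x y ∧ G.dist x y ≤ d) {u v : W} (w : H.Walk u v) :
    G.Reachable u v ∧ G.dist u v ≤ d * w.length := by
  induction w with
  | nil => simp
  | @cons x y z hxy w ih =>
    obtain ⟨hr, hd⟩ := h x y hxy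
    refine ⟨hr.trans ih.1, ?_⟩
    have := hr.dist_triangle_left z
    rw [Walk.length_cons, mul_add, mul_one]
    omega

theorem inv_dist_le_mul_inv_dist {W : Type*} {G H : SimpleGraph W} {d : ℕ}
    (h : ∀ x y, H.Adj x y → G.Reachable x y ∧ G.dist x y ≤ d) (u v : W) :
    ((H.dist u v : ℝ))⁻¹ ≤ d * ((G.dist u v : ℝ))⁻¹ := by
  rcases Nat.eq_zero_or_pos (H.dist u v) with h0 | hpos
  · rw [h0, Nat.cast_zero, inv_zero]
    positivity
  · have hne : u ≠ v := by
      rintro rfl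
      simp at hpos
    obtain ⟨w, hw⟩ := (Reachable.of_dist_ne_zero hpos.ne').exists_walk_length_eq_dist
    obtain ⟨hr, hd⟩ := w.reachable_and_dist_le_mul_length_s4 h
    have hG : (0 : ℝ) < G.dist u v := by exact_mod_cast hr.pos_dist_of_ne hne
    have hH : (0 : ℝ) < H.dist u v := by exact_mod_cast hpos
    rw [hw] at hd
    have hd' : (G.dist u v : ℝ) ≤ d * H.dist u v := by exact_mod_cast hd
    rw [← div_eq_mul_inv, le_div_iff₀ hG, inv_mul_le_iff₀ hH]
    linarith

end SimpleGraph

/-- Adding edges between vertices at distance at most `d ≥ 2` multiplies the closeness of a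
non-isolated vertex by a factor less than `d`. -/
theorem Phi_lt_mul_Phi {G H : SimpleGraph V} (hGH : G ≤ H) {d : ℕ} (hd : 1 < d)
    (h : ∀ x y, H.Adj x y → G.Reachable x y ∧ G.dist x y ≤ d) {u v : V} (huv : G.Adj u v) :
    Phi H u < d * Phi G u := by
  unfold Phi
  rw [Finset.mul_sum]
  refine Finset.sum_lt_sum (fun w _ => SimpleGraph.inv_dist_le_mul_inv_dist h u w)
    ⟨v, by simp [huv.ne'], ?_⟩
  rw [SimpleGraph.dist_eq_one_iff_adj.2 huv, SimpleGraph.dist_eq_one_iff_adj.2 (hGH huv)]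
  simpa using hd

theorem alpha_lt_alpha_sup_edge (G : SimpleGraph V) {i j : V} (hij : i ≠ j)
    (hije : ¬ G.Adj i j) {p q : ℝ} (hp : 0 < p) (hq : q < 1) :
    alpha p q G i j < alpha p q (G ⊔ SimpleGraph.edge i j) i j := by
  have hadj : (G ⊔ SimpleGraph.edge i j).Adj i j := by
    simp [SimpleGraph.edge_adj, hij]
  have hc : 0 < p * (1 - q) := mul_pos hp (sub_pos.2 hq)
  have hPhi := Phi_pos_of_adj hadj.symm
  unfold alpha
  rw [if_pos hadj.reachable, SimpleGraph.dist_eq_one_iff_adj.2 hadj, Nat.cast_one, one_mul]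
  split_ifs with hr
  · have hd : 1 < G.dist i j := by
      have h0 := hr.pos_dist_of_ne hij
      have h1 : G.dist i j ≠ 1 := fun h => hije (SimpleGraph.dist_eq_one_iff_adj.1 h)
      omega
    have hedge : ∀ x y, (G ⊔ SimpleGraph.edge i j).Adj x y →
        G.Reachable x y ∧ G.dist x y ≤ G.dist i j := by
      intro x y hxy
      rw [SimpleGraph.sup_adj, SimpleGraph.edge_adj] at hxy
      rcases hxy with hxy | ⟨⟨rfl, rfl⟩ | ⟨rfl, rfl⟩, -⟩
      · exact ⟨hxy.reachable, (SimpleGraph.dist_eq_one_iff_adj.2 hxy).trans_le hd.le⟩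
      · exact ⟨hr, le_rfl⟩
      · exact ⟨hr.symm, SimpleGraph.dist_comm.le⟩
    obtain ⟨w⟩ := hr.symm
    have hw : ¬ w.Nil := SimpleGraph.Walk.not_nil_of_ne hij.symm
    exact div_lt_div_of_pos_left hc hPhi
      (Phi_lt_mul_Phi le_sup_left hd hedge (w.adj_snd hw))
  · exact div_pos hc hPhi

/-- the link `⟨ij⟩` is strictly beneficial to both `i` and `j` with
respect to their local resource availabilities from each other. -/
theorem stmt_4 (G : SimpleGraph V) (i j : V) (hij : i ≠ j) (hije : ¬ G.Adj i j)
    (p q : ℝ) (hp0 : 0 < p) (hp1 : p < 1) (hq0 : 0 < q) (hq1 : q < 1) :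
    alpha p q (G ⊔ SimpleGraph.edge i j) i j > alpha p q G i j ∧
      alpha p q (G ⊔ SimpleGraph.edge i j) j i > alpha p q G j i := by
  refine ⟨alpha_lt_alpha_sup_edge G hij hije hp0 hq1, ?_⟩
  rw [SimpleGraph.edge_comm]
  exact alpha_lt_alpha_sup_edge G hij.symm (fun h => hije h.symm) hp0 hq1
end

section
/- Suppose G has diameter at most two, i.e., d_uv(G) ≤ 2 for all distinct vertices u, v. Let i ≠ j be vertices such that ⟨ij⟩ is not an edge of G. Then Π_{k ∈ η_i(G)} α_ik(G) = Π_{k ∈ η_i(G + ⟨ij⟩) ∖ {j}} α_ik(G + ⟨ij⟩). -/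
open Finset
open scoped Classical

variable {V : Type*} [Fintype V] [DecidableEq V]

theorem SimpleGraph.dist_eq_ite_of_edist_le_two {W : Type*} {G : SimpleGraph W} {u v : W}
    (huv : u ≠ v) (h : G.edist u v ≤ 2) : G.dist u v = if G.Adj u v then 1 else 2 := by
  have hr : G.Reachable u v := by
    rw [← SimpleGraph.edist_ne_top_iff_reachable]
    exact ne_top_of_le_ne_top (by simp) h
  have hle : G.dist u v ≤ 2 := by
    rw [← hr.coe_dist_eq_edist] at h
    exact_mod_cast h
  have hpos : 0 < G.dist u v := hr.pos_dist_of_ne huv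
  split_ifs with hadj
  · exact SimpleGraph.dist_eq_one_iff_adj.mpr hadj
  · have hne : G.dist u v ≠ 1 := fun h1 => hadj (SimpleGraph.dist_eq_one_iff_adj.mp h1)
    omega

theorem SimpleGraph.sup_edge_adj_iff_of_ne {W : Type*} (G : SimpleGraph W) {i j k : W}
    (hki : k ≠ i) (hkj : k ≠ j) (v : W) :
    (G ⊔ SimpleGraph.edge i j).Adj k v ↔ G.Adj k v := by
  simp [SimpleGraph.sup_adj, SimpleGraph.edge_adj, hki, hkj]

theorem SimpleGraph.dist_sup_edge_of_edist_le_two {W : Type*} {G : SimpleGraph W} {i j k : W}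
    (hdiam : ∀ u v : W, u ≠ v → G.edist u v ≤ 2) (hki : k ≠ i) (hkj : k ≠ j) (v : W) :
    (G ⊔ SimpleGraph.edge i j).dist k v = G.dist k v := by
  rcases eq_or_ne k v with rfl | hkv
  · simp
  · have h := hdiam k v hkv
    rw [SimpleGraph.dist_eq_ite_of_edist_le_two hkv h,
      SimpleGraph.dist_eq_ite_of_edist_le_two hkv
        ((SimpleGraph.edist_anti le_sup_left).trans h)]
    simp only [G.sup_edge_adj_iff_of_ne hki hkj]

/-- in a network of diameter at most two, the product of `i`'s local
resource availabilities over its neighbors is unchanged (omitting `j`) when the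
link `⟨ij⟩` is added. -/
theorem stmt_6 (G : SimpleGraph V) (i j : V) (hij : i ≠ j) (hije : ¬ G.Adj i j)
    (hdiam : ∀ u v : V, u ≠ v → G.edist u v ≤ 2)
    (p q : ℝ) (hp0 : 0 < p) (hp1 : p < 1) (hq0 : 0 < q) (hq1 : q < 1) :
    ∏ k ∈ Finset.univ.filter (G.Adj i), alpha p q G i k =
      ∏ k ∈ (Finset.univ.filter ((G ⊔ SimpleGraph.edge i j).Adj i)).erase j,
        alpha p q (G ⊔ SimpleGraph.edge i j) i k := by
  have hset : (Finset.univ.filter ((G ⊔ SimpleGraph.edge i j).Adj i)).erase j =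
      Finset.univ.filter (G.Adj i) := by
    ext k
    simp only [Finset.mem_erase, Finset.mem_filter, Finset.mem_univ, true_and,
      SimpleGraph.sup_adj, SimpleGraph.edge_adj]
    grind
  rw [hset]
  refine Finset.prod_congr rfl fun k hk => ?_
  have hik : G.Adj i k := (Finset.mem_filter.mp hk).2
  have hki : k ≠ i := hik.ne'
  have hkj : k ≠ j := fun h => hije (h ▸ hik)
  have hdist := SimpleGraph.dist_sup_edge_of_edist_le_two hdiam hki hkj
  have hPhi : Phi (G ⊔ SimpleGraph.edge i j) k = Phi G k := by
    simp only [Phi, hdist]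
  have hr : G.Reachable i k := hik.reachable
  rw [alpha, alpha, if_pos hr, if_pos (hr.mono le_sup_left), hPhi,
    SimpleGraph.dist_comm (u := i), SimpleGraph.dist_comm (u := i), hdist]
end

section
/- Let i, j, k be pairwise distinct vertices of G such that ⟨ij⟩ is an edge of G and k and i are connected in G. If Φ_k(G) = Φ_k(G − ⟨ij⟩), then γ_k(G − ⟨ij⟩) > γ_k(G); that is, k experiences positive spillover on deletion of the link ⟨ij⟩. -/
open Finset
open scoped Classical

variable {V : Type*} [Fintype V] [DecidableEq V]

/-- Global resource availability of `u` in `G`: `γ_u(G) = 1 − Π_{v ≠ u}(1 − α_uv(G))`. -/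
noncomputable def gammaRA (p q : ℝ) (G : SimpleGraph V) (u : V) : ℝ :=
  1 - ∏ v ∈ Finset.univ.filter (· ≠ u), (1 - alpha p q G u v)

/-- Passing to a subgraph does not increase inverse distances. -/
theorem inv_dist_le_of_le {W : Type*} {G H : SimpleGraph W} (h : H ≤ G) (u v : W) :
    ((H.dist u v : ℝ))⁻¹ ≤ ((G.dist u v : ℝ))⁻¹ := by
  by_cases hr : H.Reachable u v
  · rcases eq_or_ne u v with rfl | huv
    · simp
    · have hpos : (0 : ℝ) < G.dist u v := by exact_mod_cast (hr.mono h).pos_dist_of_ne huv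
      refine inv_anti₀ hpos ?_
      exact_mod_cast hr.dist_anti h
  · rw [SimpleGraph.dist_eq_zero_of_not_reachable hr]
    simp

theorem Phi_mono {G H : SimpleGraph V} (h : H ≤ G) (u : V) : Phi H u ≤ Phi G u :=
  Finset.sum_le_sum fun v _ => inv_dist_le_of_le h u v

/-- If closeness of `u` is the same in a subgraph, all distances from `u` are the same. -/
theorem dist_eq_of_Phi_eq {G H : SimpleGraph V} (h : H ≤ G) {u : V} (hPhi : Phi G u = Phi H u)
    {v : V} (hv : v ≠ u) : H.dist u v = G.dist u v := by
  have key := (Finset.sum_eq_sum_iff_of_le fun v _ => inv_dist_le_of_le h u v).1 hPhi.symm v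
    (by simpa using hv)
  exact_mod_cast inv_injective key

theorem inv_dist_le_Phi (G : SimpleGraph V) {u v : V} (hv : v ≠ u) :
    ((G.dist u v : ℝ))⁻¹ ≤ Phi G u :=
  Finset.single_le_sum (f := fun v => ((G.dist u v : ℝ))⁻¹) (fun _ _ => by positivity)
    (by simpa using hv)

/-- Deleting an edge strictly decreases the closeness of its endpoints. -/
theorem Phi_deleteEdges_lt {G : SimpleGraph V} {i j : V} (hij : G.Adj i j) :
    Phi (G.deleteEdges {s(i, j)}) i < Phi G i := by
  refine Finset.sum_lt_sum (fun v _ => inv_dist_le_of_le (G.deleteEdges_le _) i v)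
    ⟨j, by simpa using hij.ne', ?_⟩
  rw [SimpleGraph.dist_eq_one_iff_adj.2 hij]
  have hne : (G.deleteEdges {s(i, j)}).dist i j ≠ 1 := by
    rw [Ne, SimpleGraph.dist_eq_one_iff_adj]
    simp
  rcases Nat.eq_zero_or_pos ((G.deleteEdges {s(i, j)}).dist i j) with h0 | hpos
  · simp [h0]
  · have hlt : (1 : ℝ) < (G.deleteEdges {s(i, j)}).dist i j := by
      exact_mod_cast lt_of_le_of_ne hpos hne.symm
    simpa using inv_lt_one_of_one_lt₀ hlt

theorem one_le_dist_mul_Phi {G : SimpleGraph V} {u v : V} (hr : G.Reachable u v) (huv : u ≠ v) :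
    1 ≤ (G.dist u v : ℝ) * Phi G v := by
  have hpos : (0 : ℝ) < G.dist u v := by exact_mod_cast hr.pos_dist_of_ne huv
  have hle := inv_dist_le_Phi G huv
  rw [SimpleGraph.dist_comm] at hle
  calc (1 : ℝ) = G.dist u v * (G.dist u v : ℝ)⁻¹ := (mul_inv_cancel₀ hpos.ne').symm
    _ ≤ _ := by gcongr

theorem alpha_lt_one {p q : ℝ} (hp0 : 0 < p) (hp1 : p < 1) (hq0 : 0 < q)
    (G : SimpleGraph V) {u v : V} (huv : u ≠ v) : alpha p q G u v < 1 := by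
  unfold alpha
  split_ifs with hr
  · have hle := one_le_dist_mul_Phi hr huv
    rw [div_lt_one (by linarith)]
    nlinarith
  · exact one_pos

/-- an agent `k ∉ {i,j}`, connected to `i`, whose closeness is unchanged
by the deletion of the link `⟨ij⟩`, experiences positive spillover. -/
theorem stmt_15 (G : SimpleGraph V) (i j k : V)
    (hij : i ≠ j) (hik : i ≠ k) (hjk : j ≠ k) (hije : G.Adj i j)
    (hreach : G.Reachable k i)
    (p q : ℝ) (hp0 : 0 < p) (hp1 : p < 1) (hq0 : 0 < q) (hq1 : q < 1)
    (hPhi : Phi G k = Phi (G.deleteEdges {s(i, j)}) k) :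
    gammaRA p q (G.deleteEdges {s(i, j)}) k > gammaRA p q G k := by
  have hle : G.deleteEdges {s(i, j)} ≤ G := G.deleteEdges_le _
  set H := G.deleteEdges {s(i, j)}
  have hc : 0 < p * (1 - q) := mul_pos hp0 (by linarith)
  have hdist : ∀ v, v ≠ k → H.dist k v = G.dist k v := fun v hv => dist_eq_of_Phi_eq hle hPhi hv
  have hreachable : ∀ v, v ≠ k → G.Reachable k v → H.Reachable k v := fun v hv hr => by
    by_contra hn
    have h0 := SimpleGraph.dist_eq_zero_of_not_reachable hn
    rw [hdist v hv] at h0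
    exact (hr.pos_dist_of_ne hv.symm).ne' h0
  unfold gammaRA
  refine sub_lt_sub_left (Finset.prod_lt_prod (fun v hv => ?_) (fun v hv => ?_)
    ⟨i, by simpa using hik, ?_⟩) 1
  · have hvk : v ≠ k := by simpa using hv
    exact sub_pos.2 (alpha_lt_one hp0 hp1 hq0 H hvk.symm)
  · have hvk : v ≠ k := by simpa using hv
    refine sub_le_sub_left ?_ 1
    unfold alpha
    by_cases hr : G.Reachable k v
    · have hr' := hreachable v hvk hr
      have hone := one_le_dist_mul_Phi hr' hvk.symm
      rw [if_pos hr, if_pos hr']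
      refine div_le_div_of_nonneg_left hc.le (by linarith) ?_
      rw [hdist v hvk]
      exact mul_le_mul_of_nonneg_left (Phi_mono hle v) (Nat.cast_nonneg _)
    · rw [if_neg hr, if_neg fun h => hr (h.mono hle)]
  · refine sub_lt_sub_left ?_ 1
    have hr' := hreachable i hik hreach
    have hone := one_le_dist_mul_Phi hr' hik.symm
    have hpos : (0 : ℝ) < G.dist k i := by exact_mod_cast hreach.pos_dist_of_ne hik.symm
    unfold alpha
    rw [if_pos hreach, if_pos hr']
    refine div_lt_div_of_pos_left hc (by linarith) ?_
    rw [hdist i hik]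
    exact mul_lt_mul_of_pos_left (Phi_deleteEdges_lt hije) hpos
end

section
/- Let i, j, k be pairwise distinct vertices of G, all lying in the same connected component of G, such that neither ⟨ij⟩ nor ⟨ik⟩ is an edge of G. (1) If d_ij(G) = d_ik(G), Φ_j(G) = Φ_k(G), and Φ_j(G + ⟨ij⟩) < Φ_k(G + ⟨ik⟩), then α_ij(G + ⟨ij⟩) − α_ij(G) > α_ik(G + ⟨ik⟩) − α_ik(G); that is, with respect to the gain in local resource availability, i prefers to add a link with j over k. (2) If Φ_j(G) = Φ_k(G), Φ_j(G + ⟨ij⟩) = Φ_k(G + ⟨ik⟩), and d_ij(G) > d_ik(G), then α_ij(G + ⟨ij⟩) − α_ij(G) > α_ik(G + ⟨ik⟩) − α_ik(G). -/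
open Finset
open scoped Classical

variable {V : Type*} [Fintype V] [DecidableEq V]

/-- A vertex connected to some other vertex has positive harmonic centrality. -/
theorem Phi_pos {G : SimpleGraph V} {u v : V} (huv : G.Reachable u v) (hne : u ≠ v) :
    0 < Phi G u := by
  unfold Phi
  refine Finset.sum_pos' (fun _ _ => by positivity) ⟨v, by simpa using hne.symm, ?_⟩
  have := huv.pos_dist_of_ne hne
  positivity

theorem alpha_of_adj (p q : ℝ) {G : SimpleGraph V} {u v : V} (h : G.Adj u v) :
    alpha p q G u v = p * (1 - q) / Phi G v := by
  simp [alpha, h.reachable, SimpleGraph.dist_eq_one_iff_adj.mpr h]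

theorem sup_edge_adj_self {W : Type*} (G : SimpleGraph W) {u v : W} (hne : u ≠ v) :
    (G ⊔ SimpleGraph.edge u v).Adj u v := by
  simp [SimpleGraph.edge_adj, hne]

/-- choice of link-addition partner. For `i, j, k` pairwise distinct in the
same component, with `⟨ij⟩, ⟨ik⟩ ∉ G`:
(1) if `d_ij(G) = d_ik(G)`, `Φ_j(G) = Φ_k(G)` and `Φ_j(G + ⟨ij⟩) < Φ_k(G + ⟨ik⟩)`, then the
gain in local resource availability from adding `⟨ij⟩` exceeds that from adding `⟨ik⟩`;
(2) if `Φ_j(G) = Φ_k(G)`, `Φ_j(G + ⟨ij⟩) = Φ_k(G + ⟨ik⟩)` and `d_ij(G) > d_ik(G)`, the same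
conclusion holds. -/
theorem stmt_19 (G : SimpleGraph V) (i j k : V)
    (hij : i ≠ j) (hik : i ≠ k) (hjk : j ≠ k)
    (hreachj : G.Reachable i j) (hreachk : G.Reachable i k)
    (hije : ¬ G.Adj i j) (hike : ¬ G.Adj i k)
    (p q : ℝ) (hp0 : 0 < p) (hp1 : p < 1) (hq0 : 0 < q) (hq1 : q < 1) :
    (G.edist i j = G.edist i k → Phi G j = Phi G k →
        Phi (G ⊔ SimpleGraph.edge i j) j < Phi (G ⊔ SimpleGraph.edge i k) k →
        alpha p q (G ⊔ SimpleGraph.edge i j) i j - alpha p q G i j >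
          alpha p q (G ⊔ SimpleGraph.edge i k) i k - alpha p q G i k) ∧
      (Phi G j = Phi G k →
        Phi (G ⊔ SimpleGraph.edge i j) j = Phi (G ⊔ SimpleGraph.edge i k) k →
        G.edist i k < G.edist i j →
        alpha p q (G ⊔ SimpleGraph.edge i j) i j - alpha p q G i j >
          alpha p q (G ⊔ SimpleGraph.edge i k) i k - alpha p q G i k) := by
  have hc : 0 < p * (1 - q) := mul_pos hp0 (by linarith)
  have hadjj := sup_edge_adj_self G hij
  have hadjk := sup_edge_adj_self G hik
  rw [alpha_of_adj p q hadjj, alpha_of_adj p q hadjk, alpha, alpha, if_pos hreachj,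
    if_pos hreachk]
  refine ⟨fun hd hPhi hlt => ?_, fun hPhi hPhi' hd => ?_⟩
  · have hpos := Phi_pos hadjj.reachable.symm hij.symm
    have hdist : G.dist i j = G.dist i k := congrArg ENat.toNat hd
    rw [hdist, hPhi]
    have := div_lt_div_of_pos_left hc hpos hlt
    linarith
  · have hpos := Phi_pos hreachk.symm hik.symm
    have hdk := hreachk.pos_dist_of_ne hik
    have hdist : G.dist i k < G.dist i j := by
      rw [← hreachk.coe_dist_eq_edist, ← hreachj.coe_dist_eq_edist] at hd
      exact_mod_cast hd
    rw [hPhi, hPhi']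
    have : p * (1 - q) / ((G.dist i j : ℝ) * Phi G k) <
        p * (1 - q) / ((G.dist i k : ℝ) * Phi G k) := by
      gcongr
    linarith
end
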